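/- (Uniform stabilization, case (i).) Let (T, q) be a classical solution of the Guyer–Krumhansl system on (0,l) with boundary conditions q(0,t) = q(l,t) = 0, let C_T(t) := (μ² ∂_x q(0,t) − k T(0,t)) ∫_0^l T(s,t) ds, and suppose ‖C_T‖_∞ := sup_{t ≥ 0} |C_T(t)| is finite. With β := min(2k/(ρc), 4(l² + μ²)/τ_q), ω := β/(3l² + 3μ² + 2τ_q k/(ρc)), M₀ := (3l² + 3μ² + 2τ_q k/(ρc))/(l² + μ²), and M₁ := 2/((l² + μ²) ω), the functional energy satisfies E(t) ≤ M₀ E(0) e^{−ωt} + M₁ ‖C_T‖_∞ for all t ≥ 0. -/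

import Mathlib

open Set MeasureTheory intervalIntegral

/-- A classical solution of the one-dimensional Guyer–Krumhansl system on `(0, l)`:
`T` is the temperature, `q` the heat flux, and `Tt, Tx, qt, qx, qxx` are the
corresponding partial derivatives (continuous on `[0,l] × [0,∞)`), satisfying
`ρ c T_t + q_x = 0` and `τ_q q_t + q − μ² q_xx + k T_x = 0` on `(0,l) × (0,∞)`,
with adiabatic boundary conditions `q(0,t) = q(l,t) = 0` for all `t ≥ 0`. -/
structure IsGKSolution (l ρ c τq μ2 k : ℝ)
    (T q Tt Tx qt qx qxx : ℝ → ℝ → ℝ) : Prop where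
  contT : ContinuousOn (fun p : ℝ × ℝ => T p.1 p.2) (Icc (0:ℝ) l ×ˢ Ici (0:ℝ))
  contq : ContinuousOn (fun p : ℝ × ℝ => q p.1 p.2) (Icc (0:ℝ) l ×ˢ Ici (0:ℝ))
  hTt : ∀ x ∈ Icc (0:ℝ) l, ∀ t ∈ Ici (0:ℝ),
    HasDerivWithinAt (fun s => T x s) (Tt x t) (Ici (0:ℝ)) t
  hTx : ∀ x ∈ Icc (0:ℝ) l, ∀ t ∈ Ici (0:ℝ),
    HasDerivWithinAt (fun y => T y t) (Tx x t) (Icc (0:ℝ) l) x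
  hqt : ∀ x ∈ Icc (0:ℝ) l, ∀ t ∈ Ici (0:ℝ),
    HasDerivWithinAt (fun s => q x s) (qt x t) (Ici (0:ℝ)) t
  hqx : ∀ x ∈ Icc (0:ℝ) l, ∀ t ∈ Ici (0:ℝ),
    HasDerivWithinAt (fun y => q y t) (qx x t) (Icc (0:ℝ) l) x
  hqxx : ∀ x ∈ Icc (0:ℝ) l, ∀ t ∈ Ici (0:ℝ),
    HasDerivWithinAt (fun y => qx y t) (qxx x t) (Icc (0:ℝ) l) x
  contTt : ContinuousOn (fun p : ℝ × ℝ => Tt p.1 p.2) (Icc (0:ℝ) l ×ˢ Ici (0:ℝ))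
  contTx : ContinuousOn (fun p : ℝ × ℝ => Tx p.1 p.2) (Icc (0:ℝ) l ×ˢ Ici (0:ℝ))
  contqt : ContinuousOn (fun p : ℝ × ℝ => qt p.1 p.2) (Icc (0:ℝ) l ×ˢ Ici (0:ℝ))
  contqx : ContinuousOn (fun p : ℝ × ℝ => qx p.1 p.2) (Icc (0:ℝ) l ×ˢ Ici (0:ℝ))
  contqxx : ContinuousOn (fun p : ℝ × ℝ => qxx p.1 p.2) (Icc (0:ℝ) l ×ˢ Ici (0:ℝ))
  pde1 : ∀ x ∈ Ioo (0:ℝ) l, ∀ t ∈ Ioi (0:ℝ), ρ * c * Tt x t + qx x t = 0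
  pde2 : ∀ x ∈ Ioo (0:ℝ) l, ∀ t ∈ Ioi (0:ℝ),
    τq * qt x t + q x t - μ2 * qxx x t + k * Tx x t = 0
  bc0 : ∀ t : ℝ, 0 ≤ t → q 0 t = 0
  bcl : ∀ t : ℝ, 0 ≤ t → q l t = 0

/-- The functional energy `E(t) = (ρc/2)∫₀ˡ T² dx + (τ_q/(2k))∫₀ˡ q² dx`. -/
noncomputable def gkEnergy (l ρ c τq k : ℝ) (T q : ℝ → ℝ → ℝ) (t : ℝ) : ℝ :=
  ρ * c / 2 * (∫ x in (0:ℝ)..l, (T x t) ^ 2)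
    + τq / (2 * k) * (∫ x in (0:ℝ)..l, (q x t) ^ 2)

/-- The auxiliary functional
`F(t) = (ρc/2)∫₀ˡ (∫ₓˡ T ds)² dx + (ρcμ²/2)∫₀ˡ T² dx + τ_q ∫₀ˡ q (∫ₓˡ T ds) dx`. -/
noncomputable def gkF (l ρ c τq μ2 : ℝ) (T q : ℝ → ℝ → ℝ) (t : ℝ) : ℝ :=
  ρ * c / 2 * (∫ x in (0:ℝ)..l, (∫ s in x..l, T s t) ^ 2)
    + ρ * c * μ2 / 2 * (∫ x in (0:ℝ)..l, (T x t) ^ 2)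
    + τq * (∫ x in (0:ℝ)..l, q x t * (∫ s in x..l, T s t))

/-- The boundary term `C_T(t) = (μ² ∂ₓq(0,t) − k T(0,t)) ∫₀ˡ T(s,t) ds`. -/
noncomputable def gkCT (l μ2 k : ℝ) (T qx : ℝ → ℝ → ℝ) (t : ℝ) : ℝ :=
  (μ2 * qx 0 t - k * T 0 t) * ∫ s in (0:ℝ)..l, T s t

theorem gk_cont_ext {a b : ℝ} (hab : a ≤ b) {f : ℝ → ℝ → ℝ}
    (hf : ContinuousOn (fun p : ℝ × ℝ => f p.1 p.2) (Icc a b ×ˢ Ici (0:ℝ))) :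
    Continuous (fun p : ℝ × ℝ => f (max a (min b p.1)) (max 0 p.2)) := by
  have h : Continuous (fun p : ℝ × ℝ => ((max a (min b p.1), max 0 p.2) : ℝ × ℝ)) := by fun_prop
  exact hf.comp_continuous h (fun p => ⟨⟨le_max_left _ _, max_le hab (min_le_left _ _)⟩,
    mem_Ici.2 (le_max_left _ _)⟩)

theorem gk_slice {a b : ℝ} {f : ℝ → ℝ → ℝ}
    (hf : ContinuousOn (fun p : ℝ × ℝ => f p.1 p.2) (Icc a b ×ˢ Ici (0:ℝ))) {t : ℝ} (ht : 0 ≤ t) :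
    ContinuousOn (fun x => f x t) (Icc a b) := by
  have h : Continuous (fun x : ℝ => ((x, t) : ℝ × ℝ)) := by fun_prop
  exact hf.comp h.continuousOn (fun x hx => ⟨hx, ht⟩)

theorem gk_int_ext {a b : ℝ} {f : ℝ → ℝ → ℝ} {t : ℝ} (ht : 0 ≤ t)
    {x : ℝ} (hx : x ∈ Icc a b) :
    ∫ s in x..b, f s t = ∫ s in x..b, f (max a (min b s)) (max 0 t) := by
  apply intervalIntegral.integral_congr
  intro s hs
  rw [uIcc_of_le hx.2] at hs
  simp only
  rw [min_eq_right hs.2, max_eq_right (hx.1.trans hs.1), max_eq_right ht]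

theorem gk_param_cont {a b : ℝ} (hab : a ≤ b) {f : ℝ → ℝ → ℝ}
    (hf : ContinuousOn (fun p : ℝ × ℝ => f p.1 p.2) (Icc a b ×ˢ Ici (0:ℝ))) :
    ContinuousOn (fun p : ℝ × ℝ => ∫ s in p.1..b, f s p.2) (Icc a b ×ˢ Ici (0:ℝ)) := by
  have h := gk_cont_ext hab hf
  have h2 : Continuous (fun p : ℝ × ℝ => -∫ s in b..p.1, f (max a (min b s)) (max 0 p.2)) := by
    apply Continuous.neg
    apply intervalIntegral.continuous_parametric_intervalIntegral_of_continuous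
      (f := fun (p : ℝ × ℝ) s => f (max a (min b s)) (max 0 p.2)) _ continuous_fst
    have h3 : Continuous (fun z : (ℝ × ℝ) × ℝ => ((z.2, z.1.2) : ℝ × ℝ)) := by fun_prop
    exact h.comp h3
  refine h2.continuousOn.congr ?_
  rintro ⟨x, t⟩ ⟨hx, ht⟩
  simp only
  rw [gk_int_ext ht hx, intervalIntegral.integral_symm]

theorem gk_param_deriv {a b : ℝ} (hab : a ≤ b) {f f' : ℝ → ℝ → ℝ}
    (hf : ContinuousOn (fun p : ℝ × ℝ => f p.1 p.2) (Icc a b ×ˢ Ici (0:ℝ)))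
    (hf' : ContinuousOn (fun p : ℝ × ℝ => f' p.1 p.2) (Icc a b ×ˢ Ici (0:ℝ)))
    (hd : ∀ x ∈ Icc a b, ∀ t, 0 < t → HasDerivAt (fun s => f x s) (f' x t) t)
    {t : ℝ} (ht : 0 < t) :
    HasDerivAt (fun s => ∫ x in a..b, f x s) (∫ x in a..b, f' x t) t := by
  have hK : IsCompact (Icc a b ×ˢ Icc (0:ℝ) (t+1)) := isCompact_Icc.prod isCompact_Icc
  obtain ⟨C, hC⟩ := hK.exists_bound_of_continuousOn
    (hf'.mono (prod_mono_right Icc_subset_Ici_self))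
  have hI : ∀ (g : ℝ → ℝ → ℝ),
      ContinuousOn (fun p : ℝ × ℝ => g p.1 p.2) (Icc a b ×ˢ Ici (0:ℝ)) → ∀ s, 0 ≤ s →
      IntervalIntegrable (fun x => g x s) volume a b := fun g hg s hs =>
    ContinuousOn.intervalIntegrable_of_Icc hab (gk_slice hg hs)
  have hsub : ∀ x, x ∈ uIoc a b → x ∈ Icc a b := by
    intro x hx
    rw [uIoc_of_le hab] at hx
    exact Ioc_subset_Icc_self hx
  refine (intervalIntegral.hasDerivAt_integral_of_dominated_loc_of_deriv_le
    (F := fun s x => f x s) (F' := fun s x => f' x s) (bound := fun _ => C)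
    (s := Ioo 0 (t+1)) (Ioo_mem_nhds ht (by linarith)) ?_ (hI f hf t ht.le) ?_ ?_ ?_ ?_).2
  · filter_upwards [Ioo_mem_nhds ht (by linarith : t < t + 1)] with s hs
    have := (hI f hf s hs.1.le).def'.aestronglyMeasurable
    exact this
  · exact (hI f' hf' t ht.le).def'.aestronglyMeasurable
  · refine Filter.Eventually.of_forall fun x hx s hs => ?_
    exact hC (x, s) ⟨hsub x hx, hs.1.le, hs.2.le⟩
  · exact intervalIntegrable_const
  · refine Filter.Eventually.of_forall fun x hx s hs => ?_
    exact hd x (hsub x hx) s hs.1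

theorem gk_gronwall {L L' : ℝ → ℝ} {ω M : ℝ} (hω : 0 < ω) (hM : 0 ≤ M)
    (hc : ContinuousOn L (Ici 0)) (hd : ∀ t, 0 < t → HasDerivAt L (L' t) t)
    (hle : ∀ t, 0 < t → L' t ≤ -ω * L t + M) {t : ℝ} (ht : 0 ≤ t) :
    L t ≤ L 0 * Real.exp (-ω * t) + M / ω := by
  have hder : ∀ s, 0 < s → HasDerivAt (fun s => (L s - M / ω) * Real.exp (ω * s))
      (L' s * Real.exp (ω * s) + (L s - M / ω) * (Real.exp (ω * s) * ω)) s := by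
    intro s hs
    have h1 : HasDerivAt (fun s => Real.exp (ω * s)) (Real.exp (ω * s) * ω) s := by
      have := ((hasDerivAt_id s).const_mul ω).exp
      simpa using this
    exact ((hd s hs).sub_const _).mul h1
  have hanti : AntitoneOn (fun s => (L s - M / ω) * Real.exp (ω * s)) (Ici 0) := by
    apply antitoneOn_of_deriv_nonpos (convex_Ici 0)
    · exact (hc.sub continuousOn_const).mul (by fun_prop)
    · intro s hs
      rw [interior_Ici] at hs
      exact (hder s hs).differentiableAt.differentiableWithinAt
    · intro s hs
      rw [interior_Ici] at hs
      rw [(hder s hs).deriv]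
      have h2 := hle s hs
      have h3 : L' s * Real.exp (ω * s) + (L s - M / ω) * (Real.exp (ω * s) * ω)
        = (L' s + ω * L s - M) * Real.exp (ω * s) := by
        field_simp
        ring
      rw [h3]
      exact mul_nonpos_of_nonpos_of_nonneg (by linarith) (Real.exp_pos _).le
  have h := hanti (by simp) (show t ∈ Ici (0:ℝ) from ht) ht
  simp only [mul_zero, Real.exp_zero, mul_one] at h
  have he : Real.exp (ω * t) * Real.exp (-ω * t) = 1 := by
    rw [← Real.exp_add]; simp
  have h5 := mul_le_mul_of_nonneg_right h (Real.exp_pos (-ω * t)).le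
  rw [mul_assoc, he] at h5
  have h6 : 0 ≤ M / ω * Real.exp (-ω * t) := by positivity
  nlinarith

theorem gk_cs {f : ℝ → ℝ} {x l : ℝ} (hx : x ∈ Icc 0 l) (hf : ContinuousOn f (Icc 0 l)) :
    (∫ s in x..l, f s) ^ 2 ≤ (l - x) * ∫ s in (0:ℝ)..l, f s ^ 2 := by
  have hl : 0 ≤ l := hx.1.trans hx.2
  have hfx : ContinuousOn f (Icc x l) := hf.mono (Icc_subset_Icc_left hx.1)
  have i1 : IntervalIntegrable f volume x l := hfx.intervalIntegrable_of_Icc hx.2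
  have i2 : IntervalIntegrable (fun s => f s ^ 2) volume x l :=
    (hfx.pow 2).intervalIntegrable_of_Icc hx.2
  have i3 : IntervalIntegrable (fun s => f s ^ 2) volume 0 x :=
    ((hf.mono (Icc_subset_Icc_right hx.2)).pow 2).intervalIntegrable_of_Icc hx.1
  have h1 : ∫ s in x..l, f s ^ 2 ≤ ∫ s in (0:ℝ)..l, f s ^ 2 := by
    rw [← intervalIntegral.integral_add_adjacent_intervals i3 i2]
    have : 0 ≤ ∫ s in (0:ℝ)..x, f s ^ 2 :=
      intervalIntegral.integral_nonneg hx.1 (fun s _ => sq_nonneg _)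
    linarith
  refine le_trans ?_ (mul_le_mul_of_nonneg_left h1 (sub_nonneg.2 hx.2))
  rcases eq_or_lt_of_le hx.2 with h | h
  · subst h; simp
  · set G := ∫ s in x..l, f s with hG
    have h2 : 0 ≤ ∫ s in x..l, ((l - x) * f s - G) ^ 2 :=
      intervalIntegral.integral_nonneg hx.2 (fun s _ => sq_nonneg _)
    have h3 : ∫ s in x..l, ((l - x) * f s - G) ^ 2
        = (l - x) ^ 2 * (∫ s in x..l, f s ^ 2) - (2 * (l - x) * G) * G + (l - x) * G ^ 2 := by
      have : (fun s => ((l - x) * f s - G) ^ 2)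
          = fun s => (l - x) ^ 2 * f s ^ 2 - (2 * (l - x) * G) * f s + G ^ 2 := by
        ext s; ring
      rw [this, intervalIntegral.integral_add ((i2.const_mul _).sub (i1.const_mul _))
        intervalIntegrable_const, intervalIntegral.integral_sub (i2.const_mul _) (i1.const_mul _),
        intervalIntegral.integral_const_mul, intervalIntegral.integral_const_mul,
        intervalIntegral.integral_const, ← hG, smul_eq_mul]
    rw [h3] at h2
    have hy : 0 < l - x := sub_pos.2 h
    have h4 : 0 ≤ (l - x) * ((l - x) * (∫ s in x..l, f s ^ 2) - G ^ 2) := by nlinarith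
    have := nonneg_of_mul_nonneg_right h4 hy
    linarith

/-- uniform stabilization, case (i): if
`‖C_T‖_∞ = sup_{t ≥ 0} |C_T(t)|` is finite, then with
`β = min(2k/(ρc), 4(l²+μ²)/τ_q)`, `ω = β/(3l²+3μ²+2τ_q k/(ρc))`,
`M₀ = (3l²+3μ²+2τ_q k/(ρc))/(l²+μ²)` and `M₁ = 2/((l²+μ²)ω)`, the energy satisfies
`E(t) ≤ M₀ E(0) e^{−ωt} + M₁ ‖C_T‖_∞` for all `t ≥ 0`. -/
theorem gk_uniform_stabilization_case_i
    (l ρ c τq μ2 k : ℝ) (hl : 0 < l) (hρ : 0 < ρ) (hc : 0 < c)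
    (hτq : 0 < τq) (hμ2 : 0 < μ2) (hk : 0 < k)
    (T q Tt Tx qt qx qxx : ℝ → ℝ → ℝ)
    (hgk : IsGKSolution l ρ c τq μ2 k T q Tt Tx qt qx qxx)
    (hbdd : BddAbove ((fun t => |gkCT l μ2 k T qx t|) '' Ici (0:ℝ)))
    (β ω M₀ M₁ : ℝ)
    (hβ : β = min (2 * k / (ρ * c)) (4 * (l ^ 2 + μ2) / τq))
    (hω : ω = β / (3 * l ^ 2 + 3 * μ2 + 2 * (τq * k / (ρ * c))))
    (hM₀ : M₀ = (3 * l ^ 2 + 3 * μ2 + 2 * (τq * k / (ρ * c))) / (l ^ 2 + μ2))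
    (hM₁ : M₁ = 2 / ((l ^ 2 + μ2) * ω)) :
    ∀ t : ℝ, 0 ≤ t →
      gkEnergy l ρ c τq k T q t
        ≤ M₀ * gkEnergy l ρ c τq k T q 0 * Real.exp (-ω * t)
          + M₁ * sSup ((fun t => |gkCT l μ2 k T qx t|) '' Ici (0:ℝ)) := by
  have hr : 0 < ρ * c := mul_pos hρ hc
  set r := ρ * c with hrdef
  set κ := τq * k / r with hκ
  have hκ0 : 0 < κ := by positivity
  set N := 2 * (l ^ 2 + μ2) + κ with hN
  have hN0 : 0 < N := by positivity
  have hβ0 : 0 < β := by rw [hβ]; apply lt_min <;> positivity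
  have hβ1 : β * (r / 2) ≤ k := by
    have h1 : β ≤ 2 * k / r := hβ ▸ min_le_left _ _
    rw [le_div_iff₀ hr] at h1
    linarith
  have hβ2 : β * (τq / (2 * k)) ≤ N / k - τq / r := by
    have h1 : β ≤ 4 * (l ^ 2 + μ2) / τq := hβ ▸ min_le_right _ _
    rw [le_div_iff₀ hτq] at h1
    have h2 : N / k - τq / r = 4 * (l ^ 2 + μ2) / (2 * k) := by
      rw [hN, hκ]; field_simp; ring
    rw [h2, ← mul_div_assoc]
    gcongr
  set K := 3 * l ^ 2 + 3 * μ2 + 2 * κ with hK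
  have hK0 : 0 < K := by positivity
  have hω0 : 0 < ω := by rw [hω]; positivity
  have hl2 : 0 < l ^ 2 + μ2 := by positivity
  obtain ⟨contT, contq, hTt, hTx, hqt, hqx, hqxx, contTt, contTx, contqt, contqx, contqxx,
    pde1, pde2, bc0, bcl⟩ := hgk
  set S := sSup ((fun t => |gkCT l μ2 k T qx t|) '' Ici (0:ℝ)) with hS
  have hSle : ∀ t, 0 ≤ t → |gkCT l μ2 k T qx t| ≤ S := fun t ht =>
    le_csSup hbdd ⟨t, ht, rfl⟩
  have hS0 : 0 ≤ S := (abs_nonneg _).trans (hSle 0 le_rfl)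
  -- the primitive
  let G : ℝ → ℝ → ℝ := fun x t => ∫ s in x..l, T s t
  have contG : ContinuousOn (fun p : ℝ × ℝ => G p.1 p.2) (Icc (0:ℝ) l ×ˢ Ici (0:ℝ)) :=
    gk_param_cont hl.le contT
  have hTt' : ∀ x ∈ Icc (0:ℝ) l, ∀ t, 0 < t → HasDerivAt (fun s => T x s) (Tt x t) t :=
    fun x hx t ht => (hTt x hx t ht.le).hasDerivAt (Ici_mem_nhds ht)
  have hqt' : ∀ x ∈ Icc (0:ℝ) l, ∀ t, 0 < t → HasDerivAt (fun s => q x s) (qt x t) t :=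
    fun x hx t ht => (hqt x hx t ht.le).hasDerivAt (Ici_mem_nhds ht)
  have hTx' : ∀ x ∈ Ioo (0:ℝ) l, ∀ t, 0 ≤ t → HasDerivAt (fun y => T y t) (Tx x t) x :=
    fun x hx t ht => (hTx x (Ioo_subset_Icc_self hx) t ht).hasDerivAt (Icc_mem_nhds hx.1 hx.2)
  have hqx' : ∀ x ∈ Ioo (0:ℝ) l, ∀ t, 0 ≤ t → HasDerivAt (fun y => q y t) (qx x t) x :=
    fun x hx t ht => (hqx x (Ioo_subset_Icc_self hx) t ht).hasDerivAt (Icc_mem_nhds hx.1 hx.2)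
  have hqxx' : ∀ x ∈ Ioo (0:ℝ) l, ∀ t, 0 ≤ t → HasDerivAt (fun y => qx y t) (qxx x t) x :=
    fun x hx t ht => (hqxx x (Ioo_subset_Icc_self hx) t ht).hasDerivAt (Icc_mem_nhds hx.1 hx.2)
  have hGt : ∀ x ∈ Icc (0:ℝ) l, ∀ t, 0 < t → HasDerivAt (fun s => G x s) (q x t / r) t := by
    intro x hx t ht
    have hsub : Icc x l ×ˢ Ici (0:ℝ) ⊆ Icc (0:ℝ) l ×ˢ Ici (0:ℝ) :=
      prod_mono_left (Icc_subset_Icc_left hx.1)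
    have h1 := gk_param_deriv hx.2 (contT.mono hsub) (contTt.mono hsub)
      (fun y hy s hs => hTt' y ⟨hx.1.trans hy.1, hy.2⟩ s hs) ht
    have h2 : ∫ y in x..l, Tt y t = (-(q l t) / r) - (-(q x t) / r) := by
      apply intervalIntegral.integral_eq_sub_of_hasDerivAt_of_le hx.2
        (f := fun y => -(q y t) / r)
      · exact ((gk_slice contq ht.le).mono (Icc_subset_Icc_left hx.1)).neg.div_const _
      · intro y hy
        have hy' : y ∈ Ioo 0 l := ⟨hx.1.trans_lt hy.1, hy.2⟩
        have h3 := (hqx' y hy' t ht.le).neg.div_const r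
        refine h3.congr_deriv ?_
        have := pde1 y hy' t ht
        rw [div_eq_iff hr.ne']
        linarith
      · exact ((gk_slice contTt ht.le).mono (Icc_subset_Icc_left hx.1)).intervalIntegrable_of_Icc
          hx.2
    rw [h2, bcl t ht.le] at h1
    convert h1 using 1
    ring
  have hGx : ∀ x ∈ Ioo (0:ℝ) l, ∀ t, 0 ≤ t → HasDerivAt (fun y => G y t) (-(T x t)) x := by
    intro x hx t ht
    have hcT := gk_slice contT ht
    apply intervalIntegral.integral_hasDerivAt_left
    · exact (hcT.mono (Icc_subset_Icc_left hx.1.le)).intervalIntegrable_of_Icc hx.2.le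
    · exact (hcT.mono Ioo_subset_Icc_self).stronglyMeasurableAtFilter isOpen_Ioo x hx
    · exact hcT.continuousAt (Icc_mem_nhds hx.1 hx.2)
  have hGl : ∀ t, G l t = 0 := fun t => intervalIntegral.integral_same
  -- densities
  let e : ℝ → ℝ → ℝ := fun x t => r / 2 * T x t ^ 2 + τq / (2 * k) * q x t ^ 2
  let P : ℝ → ℝ → ℝ := fun x t => N * (r / 2 * T x t ^ 2 + τq / (2 * k) * q x t ^ 2)
    + r / 2 * G x t ^ 2 + r * μ2 / 2 * T x t ^ 2 + τq * (q x t * G x t)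
  let P' : ℝ → ℝ → ℝ := fun x t => N * (r * T x t * Tt x t + τq / k * q x t * qt x t)
    + G x t * q x t + r * μ2 * T x t * Tt x t + τq * (qt x t * G x t + q x t * (q x t / r))
  let V : ℝ → ℝ → ℝ := fun x t => N * (μ2 / k * (q x t * qx x t) - T x t * q x t)
    + μ2 * (G x t * qx x t) - k * (G x t * T x t)
  let V' : ℝ → ℝ → ℝ := fun x t => N * (μ2 / k * (qx x t * qx x t + q x t * qxx x t)
      - (Tx x t * q x t + T x t * qx x t))
    + μ2 * (-(T x t) * qx x t + G x t * qxx x t) - k * (-(T x t) * T x t + G x t * Tx x t)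
  have conte : ContinuousOn (fun p : ℝ × ℝ => e p.1 p.2) (Icc (0:ℝ) l ×ˢ Ici (0:ℝ)) := by
    simp only [e]; fun_prop
  have contP : ContinuousOn (fun p : ℝ × ℝ => P p.1 p.2) (Icc (0:ℝ) l ×ˢ Ici (0:ℝ)) := by
    simp only [P]; fun_prop
  have contP' : ContinuousOn (fun p : ℝ × ℝ => P' p.1 p.2) (Icc (0:ℝ) l ×ˢ Ici (0:ℝ)) := by
    simp only [P']; fun_prop
  have contV : ContinuousOn (fun p : ℝ × ℝ => V p.1 p.2) (Icc (0:ℝ) l ×ˢ Ici (0:ℝ)) := by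
    simp only [V]; fun_prop
  have contV' : ContinuousOn (fun p : ℝ × ℝ => V' p.1 p.2) (Icc (0:ℝ) l ×ˢ Ici (0:ℝ)) := by
    simp only [V']; fun_prop
  have hI : ∀ (g : ℝ → ℝ → ℝ),
      ContinuousOn (fun p : ℝ × ℝ => g p.1 p.2) (Icc 0 l ×ˢ Ici (0:ℝ)) → ∀ s, 0 ≤ s →
      IntervalIntegrable (fun x => g x s) volume 0 l := fun g hg s hs =>
    ContinuousOn.intervalIntegrable_of_Icc hl.le (gk_slice hg hs)
  have hPd : ∀ x ∈ Icc (0:ℝ) l, ∀ t, 0 < t → HasDerivAt (fun s => P x s) (P' x t) t := by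
    intro x hx t ht
    have h1 := hTt' x hx t ht
    have h2 := hqt' x hx t ht
    have h3 := hGt x hx t ht
    have h := (((((((h1.pow 2).const_mul (r/2)).add ((h2.pow 2).const_mul (τq/(2*k)))).const_mul
      N).add ((h3.pow 2).const_mul (r/2))).add ((h1.pow 2).const_mul (r*μ2/2))).add
      ((h2.mul h3).const_mul τq))
    refine h.congr_deriv ?_
    simp only [P']
    field_simp
    ring
  have hVd : ∀ x ∈ Ioo (0:ℝ) l, ∀ t, 0 ≤ t → HasDerivAt (fun y => V y t) (V' x t) x := by
    intro x hx t ht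
    have h1 := hTx' x hx t ht
    have h2 := hqx' x hx t ht
    have h3 := hqxx' x hx t ht
    have h4 := hGx x hx t ht
    exact (((((h2.mul h3).const_mul (μ2/k)).sub (h1.mul h2)).const_mul N).add
      ((h4.mul h3).const_mul μ2)).sub ((h4.mul h1).const_mul k)
  have hVint : ∀ t, 0 ≤ t → ∫ x in (0:ℝ)..l, V' x t = - gkCT l μ2 k T qx t := by
    intro t ht
    rw [intervalIntegral.integral_eq_sub_of_hasDerivAt_of_le hl.le (f := fun x => V x t)
      (gk_slice contV ht) (fun x hx => hVd x hx t ht) (hI V' contV' t ht)]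
    simp only [V, hGl, bc0 t ht, bcl t ht]
    simp only [gkCT, G]
    ring
  have hE : ∀ t, 0 ≤ t → gkEnergy l ρ c τq k T q t = ∫ x in (0:ℝ)..l, e x t := by
    intro t ht
    have i1 : IntervalIntegrable (fun x => T x t ^ 2) volume 0 l :=
      ((gk_slice contT ht).pow 2).intervalIntegrable_of_Icc hl.le
    have i2 : IntervalIntegrable (fun x => q x t ^ 2) volume 0 l :=
      ((gk_slice contq ht).pow 2).intervalIntegrable_of_Icc hl.le
    simp only [e, gkEnergy]
    rw [intervalIntegral.integral_add (i1.const_mul _) (i2.const_mul _),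
      intervalIntegral.integral_const_mul, intervalIntegral.integral_const_mul]
  have hP'le : ∀ t, 0 < t → ∫ x in (0:ℝ)..l, P' x t ≤ S - β * ∫ x in (0:ℝ)..l, e x t := by
    intro t ht
    have h1 : ∫ x in (0:ℝ)..l, P' x t ≤ ∫ x in (0:ℝ)..l, (V' x t - β * e x t) := by
      apply intervalIntegral.integral_mono_on_of_le_Ioo hl.le (hI P' contP' t ht.le)
        ((hI V' contV' t ht.le).sub ((hI e conte t ht.le).const_mul β))
      intro x hx
      have p1 : Tt x t = -(qx x t) / r := by
        have := pde1 x hx t ht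
        field_simp; linarith
      have p2 : qt x t = (μ2 * qxx x t - q x t - k * Tx x t) / τq := by
        have := pde2 x hx t ht
        field_simp; linarith
      have h3 : P' x t = V' x t - (k * T x t ^ 2 + (N / k - τq / r) * q x t ^ 2
          + N * μ2 / k * qx x t ^ 2) := by
        simp only [P', V']
        rw [p1, p2]
        field_simp
        ring
      rw [h3]
      simp only [e]
      have h4 := mul_le_mul_of_nonneg_right hβ1 (sq_nonneg (T x t))
      have h5 := mul_le_mul_of_nonneg_right hβ2 (sq_nonneg (q x t))
      have h6 : 0 ≤ N * μ2 / k * qx x t ^ 2 := by positivity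
      linarith
    rw [intervalIntegral.integral_sub (hI V' contV' t ht.le) ((hI e conte t ht.le).const_mul β),
      intervalIntegral.integral_const_mul, hVint t ht.le] at h1
    have := neg_le_of_abs_le (hSle t ht.le)
    linarith
  have hlow : ∀ t, 0 ≤ t → (l ^ 2 + μ2) * ∫ x in (0:ℝ)..l, e x t ≤ ∫ x in (0:ℝ)..l, P x t := by
    intro t ht
    rw [← intervalIntegral.integral_const_mul]
    apply intervalIntegral.integral_mono_on hl.le ((hI e conte t ht).const_mul _) (hI P contP t ht)
    intro x _
    simp only [e, P]
    have h1 : κ * (τq / (2 * k)) * q x t ^ 2 + r / 2 * G x t ^ 2 + τq * (q x t * G x t)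
      = r / 2 * (G x t + τq / r * q x t) ^ 2 := by
      rw [hκ]; field_simp; ring
    have h2 : 0 ≤ r / 2 * (G x t + τq / r * q x t) ^ 2 := by positivity
    have h3 : 0 ≤ κ * (r / 2 * T x t ^ 2) + r * μ2 / 2 * T x t ^ 2 := by positivity
    have h4 : 0 ≤ (l ^ 2 + μ2) * (r / 2 * T x t ^ 2 + τq / (2 * k) * q x t ^ 2) := by positivity
    rw [hN]
    linarith
  have hup : ∀ t, 0 ≤ t → ∫ x in (0:ℝ)..l, P x t ≤ K * ∫ x in (0:ℝ)..l, e x t := by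
    intro t ht
    set A := ∫ s in (0:ℝ)..l, T s t ^ 2 with hA
    have i1 : IntervalIntegrable (fun x => T x t ^ 2) volume 0 l :=
      ((gk_slice contT ht).pow 2).intervalIntegrable_of_Icc hl.le
    have i2 : IntervalIntegrable (fun x => (l - x) * A) volume 0 l :=
      Continuous.intervalIntegrable (by fun_prop) _ _
    have ie := hI e conte t ht
    have h1 : ∫ x in (0:ℝ)..l, P x t ≤ ∫ x in (0:ℝ)..l,
        (K * e x t + (r * ((l - x) * A) - r * l ^ 2 / 2 * T x t ^ 2)) := by
      apply intervalIntegral.integral_mono_on hl.le (hI P contP t ht)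
        ((ie.const_mul _).add ((i2.const_mul _).sub (i1.const_mul _)))
      intro x hx
      have hcs : G x t ^ 2 ≤ (l - x) * A := gk_cs hx (gk_slice contT ht)
      have hcs' := mul_le_mul_of_nonneg_left hcs hr.le
      simp only [e, P]
      have h1 : κ * (τq / (2 * k)) * q x t ^ 2 + r / 2 * G x t ^ 2 - τq * (q x t * G x t)
        = r / 2 * (G x t - τq / r * q x t) ^ 2 := by
        rw [hκ]; field_simp; ring
      have h2 : 0 ≤ r / 2 * (G x t - τq / r * q x t) ^ 2 := by positivity
      have h3 : 0 ≤ κ * (r / 2 * T x t ^ 2) := by positivity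
      have h4 : 0 ≤ (l ^ 2 + μ2) * (τq / (2 * k) * q x t ^ 2) := by positivity
      rw [hN, hK]
      linarith
    have h2 : ∫ x in (0:ℝ)..l, (l - x) * A = l ^ 2 / 2 * A := by
      rw [intervalIntegral.integral_mul_const, intervalIntegral.integral_sub
        intervalIntegrable_const (Continuous.intervalIntegrable (by fun_prop) _ _),
        intervalIntegral.integral_const, integral_id]
      simp only [smul_eq_mul]
      ring
    rw [intervalIntegral.integral_add (ie.const_mul _) ((i2.const_mul _).sub (i1.const_mul _)),
      intervalIntegral.integral_sub (i2.const_mul _) (i1.const_mul _),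
      intervalIntegral.integral_const_mul, intervalIntegral.integral_const_mul,
      intervalIntegral.integral_const_mul, h2, ← hA] at h1
    linarith
  have hLc : ContinuousOn (fun t => ∫ x in (0:ℝ)..l, P x t) (Ici 0) := by
    have h : Continuous (fun t : ℝ => (((0:ℝ), t) : ℝ × ℝ)) := by fun_prop
    exact (gk_param_cont hl.le contP).comp h.continuousOn
      (fun t ht => ⟨left_mem_Icc.2 hl.le, ht⟩)
  intro t ht
  have hfin := gk_gronwall (L := fun t => ∫ x in (0:ℝ)..l, P x t)
    (L' := fun t => ∫ x in (0:ℝ)..l, P' x t) hω0 hS0 hLc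
    (fun s hs => gk_param_deriv hl.le contP contP' hPd hs) (fun s hs => by
      have h1 := hP'le s hs
      have h2 := mul_le_mul_of_nonneg_left (hup s hs.le) hω0.le
      have h3 : ω * (K * ∫ x in (0:ℝ)..l, e x s) = β * ∫ x in (0:ℝ)..l, e x s := by
        rw [hω]; field_simp
      linarith) ht
  rw [hE t ht, hE 0 le_rfl, hM₀, hM₁]
  have h1 := hlow t ht
  have h2 := mul_le_mul_of_nonneg_right (hup 0 le_rfl) (Real.exp_pos (-ω * t)).le
  have h3 : 0 ≤ S / ω := by positivity
  refine le_of_mul_le_mul_left ?_ hl2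
  have h4 : (l ^ 2 + μ2) * (K / (l ^ 2 + μ2) * (∫ x in (0:ℝ)..l, e x 0) * Real.exp (-ω * t)
      + 2 / ((l ^ 2 + μ2) * ω) * S)
      = K * (∫ x in (0:ℝ)..l, e x 0) * Real.exp (-ω * t) + 2 * (S / ω) := by
    field_simp
  rw [h4]
  linarith
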